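/- arXiv:1509.08675 — 2 statements merged into one kernel-verified Lean document; each statement's English description precedes it below -/
import Mathlib

section
/- Let 𝔄 be a unital complex Banach algebra and let H ∈ 𝔄 have spectrum disjoint from ℝ. Then Q := pol H is a skew-involution commuting with H, i.e. Q² = −1 and QH = HQ. -/
/-- The polarization `pol H := (1/(2π)) ∫₀^{2π} ((−sin t)·1 + (cos t)·H)·((cos t)·1 + (sin t)·H)⁻¹ dt`
in a unital complex Banach algebra. -/
noncomputable def pol {𝔄 : Type*} [NormedRing 𝔄] [NormedAlgebra ℂ 𝔄] [CompleteSpace 𝔄]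
    (H : 𝔄) : 𝔄 :=
  (2 * Real.pi)⁻¹ • ∫ t in (0:ℝ)..(2 * Real.pi),
    ((-Real.sin t) • (1 : 𝔄) + (Real.cos t) • H) *
      Ring.inverse ((Real.cos t) • (1 : 𝔄) + (Real.sin t) • H)

open MeasureTheory Real

section IntervalIntegral

variable {A : Type*} [NormedRing A] [NormedAlgebra ℝ A] [CompleteSpace A] {f : ℝ → A}

lemma intervalIntegral_mul_const_of_continuous (hf : Continuous f) (c : A) (a b : ℝ) :
    ∫ t in a..b, f t * c = (∫ t in a..b, f t) * c :=
  ((ContinuousLinearMap.mul ℝ A).flip c).intervalIntegral_comp_comm (hf.intervalIntegrable a b)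

lemma intervalIntegral_const_mul_of_continuous (hf : Continuous f) (c : A) (a b : ℝ) :
    ∫ t in a..b, c * f t = c * ∫ t in a..b, f t :=
  (ContinuousLinearMap.mul ℝ A c).intervalIntegral_comp_comm (hf.intervalIntegrable a b)

/-- The square of the integral of a periodic function over one period, as an iterated integral
of the products of the function with its translates. -/
lemma Function.Periodic.intervalIntegral_mul_self {T : ℝ} (hf : Continuous f)
    (hT : Function.Periodic f T) :
    (∫ t in (0 : ℝ)..T, f t) * (∫ t in (0 : ℝ)..T, f t) =
      ∫ u in (0 : ℝ)..T, ∫ t in (0 : ℝ)..T, f (t + u) * f t := by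
  have hcont : Continuous (Function.uncurry fun u t : ℝ ↦ f (t + u) * f t) := by
    simp only [Function.uncurry_def]
    fun_prop
  rw [intervalIntegral_intervalIntegral_swap
    ((hcont.continuousOn.integrableOn_compact (isCompact_uIcc.prod isCompact_uIcc)).mono_set
      (Set.prod_mono Set.uIoc_subset_uIcc Set.uIoc_subset_uIcc)),
    ← intervalIntegral_const_mul_of_continuous hf]
  refine intervalIntegral.integral_congr fun t _ ↦ ?_
  rw [intervalIntegral_mul_const_of_continuous (f := fun u ↦ f (t + u)) (by fun_prop),
    intervalIntegral.integral_comp_add_left, add_zero, hT.intervalIntegral_add_eq t 0, zero_add]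

/-- A periodic function satisfying the addition formula of the cotangent has an integral over
`[0, 2π]` whose square is `-(2π)²`. -/
lemma intervalIntegral_mul_self_of_cot_add (hf : Continuous f)
    (hT : Function.Periodic f (2 * π))
    (hadd : ∀ t u, f (t + u) * (cos u • (1 : A) + sin u • f t) = cos u • f t - sin u • (1 : A)) :
    (∫ t in (0 : ℝ)..2 * π, f t) * (∫ t in (0 : ℝ)..2 * π, f t) =
      -((2 * π) ^ 2 • (1 : A)) := by
  have hinner : ∀ u, sin u ≠ 0 →
      ∫ t in (0 : ℝ)..2 * π, f (t + u) * f t = -((2 * π) • (1 : A)) := by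
    intro u hu
    have hpt : ∀ t, f (t + u) * f t = (cos u / sin u) • (f t - f (t + u)) - (1 : A) := by
      intro t
      have h := hadd t u
      rw [mul_add, mul_smul_comm, mul_smul_comm, mul_one] at h
      apply smul_right_injective A hu
      simp only [smul_sub, smul_smul, mul_div_cancel₀ _ hu]
      rw [eq_sub_of_add_eq' h]
      abel
    simp_rw [hpt]
    have hshift : ∫ t in (0 : ℝ)..2 * π, f (t + u) = ∫ t in (0 : ℝ)..2 * π, f t := by
      rw [intervalIntegral.integral_comp_add_right, zero_add, add_comm (2 * π),
        hT.intervalIntegral_add_eq u 0, zero_add]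
    have hf' : Continuous fun t ↦ f (t + u) := by fun_prop
    rw [intervalIntegral.integral_sub ((by fun_prop : Continuous _).intervalIntegrable _ _)
        intervalIntegrable_const, intervalIntegral.integral_smul,
      intervalIntegral.integral_sub (hf.intervalIntegrable _ _) (hf'.intervalIntegrable _ _),
      hshift, sub_self, smul_zero, intervalIntegral.integral_const, sub_zero, zero_sub]
  rw [hT.intervalIntegral_mul_self hf]
  have hnull : ∀ᵐ u : ℝ, sin u ≠ 0 := by
    have hcount : {u : ℝ | sin u = 0}.Countable :=
      (Set.countable_range fun n : ℤ ↦ (n : ℝ) * π).mono fun u hu ↦ sin_eq_zero_iff.1 hu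
    exact hcount.ae_notMem volume
  rw [intervalIntegral.integral_congr_ae (hnull.mono fun u hu _ ↦ hinner u hu),
    intervalIntegral.integral_const, sub_zero, smul_neg, smul_smul, sq]

end IntervalIntegral

section Polarization

variable {𝔄 : Type*} [NormedRing 𝔄] [NormedAlgebra ℂ 𝔄]

/-- Real combinations of `1` and `H` are units when the spectrum of `H` avoids the real line. -/
lemma isUnit_smul_one_add_smul {H : 𝔄} (hH : ∀ z ∈ spectrum ℂ H, z.im ≠ 0) {a b : ℝ}
    (hab : a ≠ 0 ∨ b ≠ 0) : IsUnit (a • (1 : 𝔄) + b • H) := by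
  by_cases hb : b = 0
  · have ha : a ≠ 0 := hab.resolve_right (not_not.2 hb)
    rw [hb, zero_smul, add_zero]
    exact isUnit_one.smul (Units.mk0 a ha)
  · have hmem : ((-a / b : ℝ) : ℂ) ∉ spectrum ℂ H := fun h ↦ hH _ h (Complex.ofReal_im _)
    rw [spectrum.notMem_iff] at hmem
    convert hmem.smul (Units.mk0 (-b) (neg_ne_zero.2 hb)) using 1
    rw [Units.smul_def, Units.val_mk0, Algebra.algebraMap_eq_smul_one, Complex.coe_smul, smul_sub,
      smul_smul, neg_mul, mul_div_cancel₀ _ hb, neg_neg, neg_smul, sub_neg_eq_add]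

lemma isUnit_cos_smul_one_add_sin_smul {H : 𝔄} (hH : ∀ z ∈ spectrum ℂ H, z.im ≠ 0) (t : ℝ) :
    IsUnit (cos t • (1 : 𝔄) + sin t • H) := by
  refine isUnit_smul_one_add_smul hH ?_
  by_contra! h
  simpa [h.1, h.2] using sin_sq_add_cos_sq t

/-- The integrand in the definition of `pol H`. -/
noncomputable def polIntegrand (H : 𝔄) (t : ℝ) : 𝔄 :=
  ((-sin t) • (1 : 𝔄) + cos t • H) * Ring.inverse (cos t • (1 : 𝔄) + sin t • H)

lemma periodic_polIntegrand (H : 𝔄) : Function.Periodic (polIntegrand H) (2 * π) := by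
  intro t
  simp [polIntegrand]

lemma continuous_polIntegrand [CompleteSpace 𝔄] {H : 𝔄}
    (hH : ∀ z ∈ spectrum ℂ H, z.im ≠ 0) : Continuous (polIntegrand H) := by
  refine Continuous.mul (by fun_prop) (continuous_iff_continuousAt.2 fun t ↦ ?_)
  obtain ⟨v, hv⟩ := isUnit_cos_smul_one_add_sin_smul hH t
  refine ContinuousAt.comp (g := Ring.inverse)
    (hv ▸ NormedRing.inverse_continuousAt v) (Continuous.continuousAt (by fun_prop))

lemma polIntegrand_mul {H : 𝔄} (hH : ∀ z ∈ spectrum ℂ H, z.im ≠ 0) (t : ℝ) :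
    polIntegrand H t * (cos t • (1 : 𝔄) + sin t • H) = (-sin t) • (1 : 𝔄) + cos t • H :=
  Ring.inverse_mul_cancel_right _ _ (isUnit_cos_smul_one_add_sin_smul hH t)

lemma polIntegrand_add {H : 𝔄} (hH : ∀ z ∈ spectrum ℂ H, z.im ≠ 0) (t u : ℝ) :
    polIntegrand H (t + u) * (cos u • (1 : 𝔄) + sin u • polIntegrand H t) =
      cos u • polIntegrand H t - sin u • (1 : 𝔄) := by
  apply (isUnit_cos_smul_one_add_sin_smul hH t).mul_right_cancel
  rw [mul_assoc, add_mul, sub_mul, smul_mul_assoc, smul_mul_assoc, smul_mul_assoc, smul_mul_assoc,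
    polIntegrand_mul hH, one_mul]
  have hrot : cos u • (cos t • (1 : 𝔄) + sin t • H) + sin u • ((-sin t) • (1 : 𝔄) + cos t • H) =
      cos (t + u) • (1 : 𝔄) + sin (t + u) • H := by
    rw [cos_add, sin_add]
    module
  rw [hrot, polIntegrand_mul hH, cos_add, sin_add]
  module

lemma commute_polIntegrand {H : 𝔄} (hH : ∀ z ∈ spectrum ℂ H, z.im ≠ 0) (t : ℝ) :
    Commute (polIntegrand H t) H := by
  have hcomm : ∀ a b : ℝ, Commute (a • (1 : 𝔄) + b • H) H := fun a b ↦
    ((Commute.one_left H).smul_left a).add_left ((Commute.refl H).smul_left b)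
  refine (hcomm _ _).mul_left ?_
  obtain ⟨v, hv⟩ := isUnit_cos_smul_one_add_sin_smul hH t
  have h := hcomm (cos t) (sin t)
  rw [← hv] at h ⊢
  rw [Ring.inverse_unit]
  exact h.units_inv_left

end Polarization

theorem stmt4 {𝔄 : Type*} [NormedRing 𝔄] [NormedAlgebra ℂ 𝔄] [CompleteSpace 𝔄]
    (H : 𝔄) (hH : ∀ z ∈ spectrum ℂ H, z.im ≠ 0) :
    pol H ^ 2 = -1 ∧ pol H * H = H * pol H := by
  have hcont := continuous_polIntegrand hH
  have hpol : pol H = (2 * π)⁻¹ • ∫ t in (0 : ℝ)..2 * π, polIntegrand H t := rfl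
  constructor
  · rw [hpol, sq, smul_mul_smul_comm, intervalIntegral_mul_self_of_cot_add hcont
      (periodic_polIntegrand H) (polIntegrand_add hH), smul_neg, smul_smul, ← sq, ← mul_pow,
      inv_mul_cancel₀ two_pi_pos.ne', one_pow, one_smul]
  · rw [hpol, smul_mul_assoc, mul_smul_comm, ← intervalIntegral_mul_const_of_continuous hcont,
      ← intervalIntegral_const_mul_of_continuous hcont]
    simp_rw [(commute_polIntegrand hH _).eq]
end

section
/- Let 𝔄 be a unital complex Banach algebra and (A₁, …, Aₙ) an n-tuple in 𝔄 lying in the domain of the Gram–Schmidt orthogonalization 𝒪^{GS} (i.e. at each stage of the recursion the relevant spectrum is disjoint from ℝ). Then for an n-tuple (Q₁, …, Qₙ) in 𝔄 one has 𝒪^{GS}(A₁, …, Aₙ) = (Q₁, …, Qₙ) if and only if the following hold: (i) (Q₁, …, Qₙ) is a Clifford system; (ii) for each k, the iterated antisymmetrization H_k of A_k with respect to Q₁, …, Q_{k−1} (obtained by successively applying R ↦ ½(R − Qᵢ⁻¹ R Qᵢ) for i = 1, …, k−1) commutes with Q_k; (iii) for each k, the spectrum of H_k·Q_k⁻¹ is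 contained in the open right half-plane {z ∈ ℂ : Re z > 0}. -/
/-- The antisymmetrization `R ↦ ½(R − Q⁻¹RQ)` of `R` with respect to `Q`. -/
noncomputable def antisym {𝔄 : Type*} [Ring 𝔄] [Module ℝ 𝔄] (Q R : 𝔄) : 𝔄 :=
  (2⁻¹ : ℝ) • (R - Ring.inverse Q * R * Q)

/-- The iterated antisymmetrization of `X` with respect to `Q 1, …, Q (k-1)`
(successively, starting with `Q 1`). -/
noncomputable def gsAntisym {𝔄 : Type*} [Ring 𝔄] [Module ℝ 𝔄] {n : ℕ}
    (Q : Fin n → 𝔄) (k : Fin n) (X : 𝔄) : 𝔄 :=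
  (List.ofFn fun i : Fin (k : ℕ) => Q (Fin.castLE k.isLt.le i)).foldl
    (fun R q => antisym q R) X

/-- A Clifford system: `QᵢQⱼ + QⱼQᵢ = −2δᵢⱼ·1`. -/
def IsCliffordSystem {𝔄 : Type*} [Ring 𝔄] {n : ℕ} (Q : Fin n → 𝔄) : Prop :=
  ∀ i j, Q i * Q j + Q j * Q i = if i = j then (-2 : 𝔄) else 0

section Polarization

open MeasureTheory
open Real (cos sin pi)

lemma Commute.ringInverse_of_commute {M : Type*} [MonoidWithZero M] {a b : M} (h : Commute a b) :
    Commute a (Ring.inverse b) := by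
  by_cases hb : IsUnit b
  · obtain ⟨u, rfl⟩ := hb
    rw [Ring.inverse_unit]
    exact h.units_inv_right
  · rw [Ring.inverse_non_unit _ hb]
    exact Commute.zero_right a

lemma continuous_inverse_of_isUnit {R X : Type*} [NormedRing R] [CompleteSpace R]
    [TopologicalSpace X] {f : X → R}
    (hf : Continuous f) (hu : ∀ x, IsUnit (f x)) : Continuous fun x => Ring.inverse (f x) := by
  refine continuous_iff_continuousAt.2 fun x => ?_
  obtain ⟨u, hx⟩ := hu x
  have h := NormedRing.inverse_continuousAt u
  rw [hx] at h
  exact ContinuousAt.comp h hf.continuousAt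

lemma eq_I_or_eq_neg_I {e : ℂ} (he : e * e = -1) : e = Complex.I ∨ e = -Complex.I := by
  rw [← Complex.I_mul_I] at he
  exact mul_self_eq_mul_self_iff.1 he

variable {𝔄 : Type*} [NormedRing 𝔄] [NormedAlgebra ℂ 𝔄]

/-- The denominator `cos t + sin t H` of the integrand of `pol H`. -/
noncomputable def polDen (H : 𝔄) (t : ℝ) : 𝔄 := cos t • (1 : 𝔄) + sin t • H

/-- The numerator `-sin t + cos t H` of the integrand of `pol H`. -/
noncomputable def polNum (H : 𝔄) (t : ℝ) : 𝔄 := (-sin t) • (1 : 𝔄) + cos t • H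

/-- The integrand of `pol H`. -/
noncomputable def polInt (H : 𝔄) (t : ℝ) : 𝔄 := polNum H t * Ring.inverse (polDen H t)

lemma hasDerivAt_polDen (H : 𝔄) (t : ℝ) : HasDerivAt (polDen H) (polNum H t) t :=
  ((Real.hasDerivAt_cos t).smul_const (1 : 𝔄)).add ((Real.hasDerivAt_sin t).smul_const H)

lemma continuous_polNum (H : 𝔄) : Continuous (polNum H) := by
  unfold polNum; fun_prop

lemma continuous_polDen (H : 𝔄) : Continuous (polDen H) := by
  unfold polDen; fun_prop

lemma Commute.polDen_right {B H : 𝔄} (h : Commute B H) (t : ℝ) : Commute B (polDen H t) :=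
  ((Commute.one_right B).smul_right _).add_right (h.smul_right _)

lemma Commute.polNum_right {B H : 𝔄} (h : Commute B H) (t : ℝ) : Commute B (polNum H t) :=
  ((Commute.one_right B).smul_right _).add_right (h.smul_right _)

lemma Commute.inverse_polDen_right {B H : 𝔄} (h : Commute B H) (t : ℝ) :
    Commute B (Ring.inverse (polDen H t)) :=
  (h.polDen_right t).ringInverse_of_commute

lemma Commute.polInt_right {B H : 𝔄} (h : Commute B H) (t : ℝ) : Commute B (polInt H t) :=
  (h.polNum_right t).mul_right (h.inverse_polDen_right t)

lemma polInt_periodic (H : 𝔄) : Function.Periodic (polInt H) (2 * pi) := by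
  intro t
  simp [polInt, polNum, polDen]

lemma polDen_neg (H : 𝔄) (t : ℝ) : polDen H (-t) = cos t • (1 : 𝔄) - sin t • H := by
  simp [polDen, sub_eq_add_neg]

lemma mul_polInt_of_anticommute {B H : 𝔄} (hu : ∀ t, IsUnit (polDen H t)) (h : B * H = -(H * B))
    (t : ℝ) : B * polInt H t = -(polInt H (-t) * B) := by
  have hD : polDen H (-t) * B = B * polDen H t := by
    rw [polDen_neg]
    simp [polDen, add_mul, mul_add, h, sub_eq_add_neg]
  have hN : B * polNum H t = -(polNum H (-t) * B) := by
    simp [polNum, add_mul, mul_add, h, add_comm]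
  have hR : Ring.inverse (polDen H (-t)) * B = B * Ring.inverse (polDen H t) := by
    rw [Ring.eq_mul_inverse_iff_mul_eq _ _ _ (hu t), mul_assoc, ← hD, ← mul_assoc,
      Ring.inverse_mul_cancel _ (hu (-t)), one_mul]
  rw [polInt, polInt, ← mul_assoc, hN, neg_mul, mul_assoc, mul_assoc, hR]

lemma polInt_sub_polInt {H K : 𝔄} (hH : ∀ t, IsUnit (polDen H t)) (hK : ∀ t, IsUnit (polDen K t))
    (h : Commute H K) (t : ℝ) :
    polInt H t - polInt K t =
      (H - K) * (Ring.inverse (polDen H t) * Ring.inverse (polDen K t)) := by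
  have h1 : polInt H t = polNum H t * polDen K t *
      (Ring.inverse (polDen H t) * Ring.inverse (polDen K t)) := by
    have h2 : Commute (polDen K t) (Ring.inverse (polDen H t)) :=
      (h.symm.polDen_right t).symm.polDen_right t |>.symm.ringInverse_of_commute
    rw [mul_assoc, ← mul_assoc (polDen K t), h2.eq, mul_assoc,
      Ring.mul_inverse_cancel _ (hK t), mul_one, polInt]
  have h3 : polInt K t = polNum K t * polDen H t *
      (Ring.inverse (polDen H t) * Ring.inverse (polDen K t)) := by
    rw [mul_assoc, ← mul_assoc (polDen H t), Ring.mul_inverse_cancel _ (hH t), one_mul, polInt]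
  rw [h1, h3, ← sub_mul]
  congr 1
  have h4 := Real.sin_sq_add_cos_sq t
  simp only [polNum, polDen, mul_add, add_mul, smul_mul_assoc, mul_smul_comm, one_mul, mul_one,
    h.eq]
  have h5 : H - K = (sin t ^ 2 + cos t ^ 2) • H - (sin t ^ 2 + cos t ^ 2) • K := by
    rw [h4, one_smul, one_smul]
  rw [h5]
  module

lemma polDen_mul_polDen_neg {Q : 𝔄} (hQ : Q * Q = -1) (t : ℝ) :
    polDen Q t * polDen Q (-t) = 1 := by
  rw [polDen_neg, polDen]
  have : (cos t • (1 : 𝔄) + sin t • Q) * (cos t • (1 : 𝔄) - sin t • Q) =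
      (sin t ^ 2 + cos t ^ 2) • (1 : 𝔄) := by
    simp only [mul_sub, add_mul, smul_mul_assoc, mul_smul_comm, one_mul, mul_one, hQ]
    module
  rw [this, Real.sin_sq_add_cos_sq, one_smul]

lemma isUnit_polDen_of_mul_self {Q : 𝔄} (hQ : Q * Q = -1) (t : ℝ) : IsUnit (polDen Q t) :=
  ⟨⟨_, _, polDen_mul_polDen_neg hQ t, by simpa using polDen_mul_polDen_neg hQ (-t)⟩, rfl⟩

lemma isUnit_smul_one_add_smul_s11 {S : 𝔄} {P : ℂ → Prop}
    (hS : ∀ z, P z → IsUnit (algebraMap ℂ 𝔄 z - S)) {a b : ℂ} (h0 : b = 0 → a ≠ 0)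
    (h1 : b ≠ 0 → P (-(a / b))) : IsUnit (a • (1 : 𝔄) + b • S) := by
  by_cases hb : b = 0
  · rw [hb, zero_smul, add_zero]
    rw [← Algebra.algebraMap_eq_smul_one]
    exact (IsUnit.mk0 a (h0 hb)).map _
  · have h2 := (hS _ (h1 hb))
    have h3 : a • (1 : 𝔄) + b • S = algebraMap ℂ 𝔄 (-b) * (algebraMap ℂ 𝔄 (-(a / b)) - S) := by
      rw [mul_sub, ← map_mul, neg_mul_neg, mul_div_cancel₀ _ hb, Algebra.algebraMap_eq_smul_one,
        map_neg, neg_mul, ← Algebra.smul_def, sub_neg_eq_add]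
    rw [h3]
    exact ((IsUnit.mk0 _ (neg_ne_zero.2 hb)).map _).mul h2

lemma isUnit_polDen {H : 𝔄} (hspec : ∀ z ∈ spectrum ℂ H, z.im ≠ 0) (t : ℝ) :
    IsUnit (polDen H t) := by
  have h := isUnit_smul_one_add_smul_s11 (S := H) (P := fun z => z.im = 0)
    (fun z hz => spectrum.notMem_iff.1 fun hz' => hspec z hz' hz) (a := (cos t : ℂ)) (b := (sin t : ℂ))
    (fun h0 h1 => by
      have := Real.sin_sq_add_cos_sq t
      norm_cast at h0 h1
      rw [h0, h1] at this
      norm_num at this)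
    (fun _ => by rw [← Complex.ofReal_div, ← Complex.ofReal_neg, Complex.ofReal_im])
  rwa [Complex.coe_smul, Complex.coe_smul] at h

lemma sin_smul_one_add_polInt_mul {H : 𝔄} (hu : ∀ t, IsUnit (polDen H t)) (t v : ℝ) :
    sin v • (1 + polInt H t * polInt H (t + v)) = cos v • (polInt H t - polInt H (t + v)) := by
  have hDR : ∀ s, polDen H s * Ring.inverse (polDen H s) = 1 :=
    fun s => Ring.mul_inverse_cancel _ (hu s)
  have hRD : ∀ s, Ring.inverse (polDen H s) * polDen H s = 1 :=
    fun s => Ring.inverse_mul_cancel _ (hu s)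
  have hN : polInt H t = Ring.inverse (polDen H t) * polNum H t :=
    (((Commute.refl H).polNum_right t).symm.inverse_polDen_right t).eq
  have h1 : sin v • (polDen H t * polDen H (t + v) + polNum H t * polNum H (t + v)) =
      cos v • (polNum H t * polDen H (t + v) - polDen H t * polNum H (t + v)) := by
    have h2 := Real.sin_sq_add_cos_sq t
    simp only [polDen, polNum, Real.cos_add, Real.sin_add, mul_add, add_mul, smul_mul_assoc,
      mul_smul_comm, one_mul, mul_one]
    match_scalars <;> ring
  have h3 := congrArg (fun x => Ring.inverse (polDen H t) * x * Ring.inverse (polDen H (t + v))) h1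
  simp only [mul_smul_comm, smul_mul_assoc] at h3
  have h4 : Ring.inverse (polDen H t) *
      (polDen H t * polDen H (t + v) + polNum H t * polNum H (t + v)) *
      Ring.inverse (polDen H (t + v)) = 1 + polInt H t * polInt H (t + v) := by
    rw [hN, polInt, mul_add, add_mul, ← mul_assoc _ (polDen H t), hRD, one_mul, hDR]
    simp only [mul_assoc]
  have h5 : Ring.inverse (polDen H t) *
      (polNum H t * polDen H (t + v) - polDen H t * polNum H (t + v)) *
      Ring.inverse (polDen H (t + v)) = polInt H t - polInt H (t + v) := by
    rw [hN, polInt, mul_sub, sub_mul, ← mul_assoc _ (polDen H t), hRD, one_mul, ← mul_assoc,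
      mul_assoc _ (polDen H (t + v)), hDR, mul_one]
  rwa [h4, h5] at h3

lemma integral_polInt_add {H : 𝔄} (t : ℝ) :
    ∫ v in (0:ℝ)..(2 * pi), polInt H (t + v) = ∫ v in (0:ℝ)..(2 * pi), polInt H v := by
  rw [intervalIntegral.integral_comp_add_left]
  have := (polInt_periodic H).intervalIntegral_add_eq t 0
  simpa using this

lemma isUnit_polDen_algebraMap {z : ℂ} (hz : z.im ≠ 0) (t : ℝ) :
    IsUnit (polDen (algebraMap ℂ 𝔄 z) t) := by
  have h : polDen (algebraMap ℂ 𝔄 z) t = algebraMap ℂ 𝔄 (polDen z t) := by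
    simp only [polDen, Algebra.algebraMap_eq_smul_one, add_smul, smul_assoc, one_smul]
  rw [h]
  refine (isUnit_polDen (fun w hw => ?_) t).map _
  rw [spectrum.mem_iff, Algebra.algebraMap_self, RingHom.id_apply, isUnit_iff_ne_zero, not_not,
    sub_eq_zero] at hw
  rwa [hw]

variable [CompleteSpace 𝔄]

lemma pol_eq (H : 𝔄) : pol H = (2 * pi)⁻¹ • ∫ t in (0:ℝ)..(2 * pi), polInt H t := rfl

lemma continuous_polInt {H : 𝔄} (hu : ∀ t, IsUnit (polDen H t)) : Continuous (polInt H) :=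
  (continuous_polNum H).mul (continuous_inverse_of_isUnit (continuous_polDen H) hu)

lemma intervalIntegral_mul_left {f : ℝ → 𝔄} (hf : Continuous f) (B : 𝔄) (a b : ℝ) :
    ∫ t in a..b, B * f t = B * ∫ t in a..b, f t :=
  (ContinuousLinearMap.mul ℝ 𝔄 B).intervalIntegral_comp_comm (hf.intervalIntegrable a b)

lemma intervalIntegral_mul_right {f : ℝ → 𝔄} (hf : Continuous f) (B : 𝔄) (a b : ℝ) :
    ∫ t in a..b, f t * B = (∫ t in a..b, f t) * B :=
  ((ContinuousLinearMap.mul ℝ 𝔄).flip B).intervalIntegral_comp_comm (hf.intervalIntegrable a b)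

lemma Commute.intervalIntegral_right {f : ℝ → 𝔄} (hf : Continuous f) {B : 𝔄}
    (h : ∀ t, Commute B (f t)) (a b : ℝ) : Commute B (∫ t in a..b, f t) := by
  rw [commute_iff_eq, ← intervalIntegral_mul_left hf, ← intervalIntegral_mul_right hf]
  simp_rw [(h _).eq]

lemma Commute.pol_right {B H : 𝔄} (hu : ∀ t, IsUnit (polDen H t)) (h : Commute B H) :
    Commute B (pol H) :=
  (Commute.intervalIntegral_right (continuous_polInt hu) h.polInt_right _ _).smul_right _

lemma mul_pol_of_anticommute {B H : 𝔄} (hu : ∀ t, IsUnit (polDen H t)) (h : B * H = -(H * B)) :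
    B * pol H = -(pol H * B) := by
  have hc := continuous_polInt hu
  have hflip : ∫ t in (0:ℝ)..(2 * pi), polInt H (-t) = ∫ t in (0:ℝ)..(2 * pi), polInt H t := by
    rw [intervalIntegral.integral_comp_neg]
    have := (polInt_periodic H).intervalIntegral_add_eq (-(2 * pi)) 0
    simpa using this
  rw [pol_eq, mul_smul_comm, smul_mul_assoc, ← intervalIntegral_mul_left hc]
  simp_rw [mul_polInt_of_anticommute hu h]
  rw [intervalIntegral.integral_neg, intervalIntegral_mul_right (f := fun t => polInt H (-t)) (by fun_prop),
    hflip,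
    smul_neg]

lemma pol_sub_pol {H K : 𝔄} (hH : ∀ t, IsUnit (polDen H t)) (hK : ∀ t, IsUnit (polDen K t))
    (h : Commute H K) :
    pol H - pol K = (H - K) * ((2 * pi)⁻¹ • ∫ t in (0:ℝ)..(2 * pi),
      Ring.inverse (polDen H t) * Ring.inverse (polDen K t)) := by
  rw [pol_eq, pol_eq, ← smul_sub, ← intervalIntegral.integral_sub
    ((continuous_polInt hH).intervalIntegrable _ _) ((continuous_polInt hK).intervalIntegrable _ _)]
  simp_rw [polInt_sub_polInt hH hK h]
  rw [intervalIntegral_mul_left, mul_smul_comm]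
  exact (continuous_inverse_of_isUnit (continuous_polDen H) hH).mul
    (continuous_inverse_of_isUnit (continuous_polDen K) hK)

lemma integral_inverse_polDen_mul_self {H : 𝔄} (hH : ∀ t, IsUnit (polDen H t)) :
    ∫ t in (0:ℝ)..(2 * pi), Ring.inverse (polDen H t) * Ring.inverse (polDen H t) = 0 := by
  have hc := continuous_inverse_of_isUnit (continuous_polDen H) hH
  have hd : ∀ t, HasDerivAt (fun t => sin t • Ring.inverse (polDen H t))
      (Ring.inverse (polDen H t) * Ring.inverse (polDen H t)) t := by
    intro t
    obtain ⟨u, hut⟩ := hH t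
    have h1 := hasFDerivAt_ringInverse (𝕜 := ℝ) u
    rw [hut] at h1
    have h2 := (Real.hasDerivAt_sin t).smul (h1.comp_hasDerivAt t (hasDerivAt_polDen H t))
    convert! h2 using 1
    have h3 : cos t • polDen H t - sin t • polNum H t = 1 := by
      have h4 := Real.sin_sq_add_cos_sq t
      have : cos t • polDen H t - sin t • polNum H t = (sin t ^ 2 + cos t ^ 2) • (1 : 𝔄) := by
        simp only [polDen, polNum]; module
      rw [this, h4, one_smul]
    have h5 : Ring.inverse (polDen H t) = (↑u⁻¹ : 𝔄) := by rw [← hut, Ring.inverse_unit]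
    have h6 : (cos t • (↑u⁻¹ : 𝔄)) = ↑u⁻¹ * (cos t • polDen H t) * ↑u⁻¹ := by
      rw [← hut]; simp
    simp only [Function.comp, h5, neg_apply, ContinuousLinearMap.mulLeftRight_apply, smul_neg]
    rw [h6]
    rw [← sub_eq_neg_add, ← smul_mul_assoc, ← mul_smul_comm, ← sub_mul, ← mul_sub, h3, mul_one]
  rw [intervalIntegral.integral_eq_sub_of_hasDerivAt (fun t _ => hd t)
    ((hc.mul hc).intervalIntegrable _ _)]
  simp

lemma pol_add_eq_of_segment {H K : 𝔄} (h : Commute H K)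
    (hu : ∀ r ∈ Set.Icc (0:ℝ) 1, ∀ t, IsUnit (polDen (H + r • K) t)) : pol (H + K) = pol H := by
  have hcont : ContinuousOn (fun p : ℝ × ℝ => Ring.inverse (polDen (H + p.1 • K) p.2))
      (Set.Icc 0 1 ×ˢ Set.Icc 0 (2 * pi)) := by
    intro p hp
    obtain ⟨u, hup⟩ := hu p.1 hp.1 p.2
    have h1 := NormedRing.inverse_continuousAt u
    rw [hup] at h1
    have h2 : Continuous fun p : ℝ × ℝ => polDen (H + p.1 • K) p.2 := by
      unfold polDen; fun_prop
    exact (ContinuousAt.comp (f := fun p : ℝ × ℝ => polDen (H + p.1 • K) p.2) h1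
      h2.continuousAt).continuousWithinAt
  obtain ⟨M, hM⟩ := (isCompact_Icc.prod isCompact_Icc).exists_bound_of_continuousOn hcont
  have hcr : ∀ r ∈ Set.Icc (0:ℝ) 1, Continuous fun t => Ring.inverse (polDen (H + r • K) t) :=
    fun r hr => continuous_inverse_of_isUnit (continuous_polDen _) (hu r hr)
  have hdiff : ∀ x ∈ Set.Icc (0:ℝ) 1, ∀ y ∈ Set.Icc (0:ℝ) 1,
      ‖pol (H + y • K) - pol (H + x • K)‖ ≤
        (‖K‖ * ((2 * pi)⁻¹ * (M * M * M * ‖K‖ * (2 * pi)))) * ‖y - x‖ ^ 2 := by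
    intro x hx y hy
    have hres : ∀ t, Ring.inverse (polDen (H + y • K) t) - Ring.inverse (polDen (H + x • K) t) =
        ((x - y) * sin t) • (Ring.inverse (polDen (H + y • K) t) * K *
          Ring.inverse (polDen (H + x • K) t)) := by
      intro t
      have h1 := Ring.inverse_mul_cancel _ (hu y hy t)
      have h2 := Ring.mul_inverse_cancel _ (hu x hx t)
      have h3 : polDen (H + x • K) t - polDen (H + y • K) t = ((x - y) * sin t) • K := by
        simp only [polDen]; module
      rw [← smul_mul_assoc, ← mul_smul_comm, ← h3, mul_sub, sub_mul, h1, mul_assoc, h2, one_mul,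
        mul_one]
    have hcomm : Commute (H + y • K) (H + x • K) :=
      ((Commute.refl H).add_left (h.symm.smul_left y)).add_right
        ((h.add_left ((Commute.refl K).smul_left y)).smul_right x)
    have hint : ∀ z ∈ Set.Icc (0:ℝ) 1, IntervalIntegrable (fun t => Ring.inverse
        (polDen (H + z • K) t) * Ring.inverse (polDen (H + x • K) t)) volume 0 (2 * pi) :=
      fun z hz => ((hcr z hz).mul (hcr x hx)).intervalIntegrable _ _
    have hprod : ∫ t in (0:ℝ)..(2 * pi), Ring.inverse (polDen (H + y • K) t) *
          Ring.inverse (polDen (H + x • K) t) =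
        ∫ t in (0:ℝ)..(2 * pi), ((x - y) * sin t) • (Ring.inverse (polDen (H + y • K) t) * K *
          Ring.inverse (polDen (H + x • K) t)) * Ring.inverse (polDen (H + x • K) t) := by
      rw [← sub_zero (∫ t in (0:ℝ)..(2 * pi), Ring.inverse (polDen (H + y • K) t) *
          Ring.inverse (polDen (H + x • K) t)), ← integral_inverse_polDen_mul_self (hu x hx),
        ← intervalIntegral.integral_sub (hint y hy) (hint x hx)]
      simp_rw [← sub_mul, hres]
    rw [pol_sub_pol (hu y hy) (hu x hx) hcomm, hprod]
    have hKK : H + y • K - (H + x • K) = (y - x) • K := by module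
    have hbound : ‖∫ t in (0:ℝ)..(2 * pi), ((x - y) * sin t) •
        (Ring.inverse (polDen (H + y • K) t) * K * Ring.inverse (polDen (H + x • K) t)) *
          Ring.inverse (polDen (H + x • K) t)‖ ≤
        (‖y - x‖ * (M * M * M * ‖K‖)) * |2 * pi - 0| := by
      refine intervalIntegral.norm_integral_le_of_norm_le_const fun t ht => ?_
      rw [Set.uIoc_of_le Real.two_pi_pos.le] at ht
      have ht' : t ∈ Set.Icc 0 (2 * pi) := ⟨ht.1.le, ht.2⟩
      have hMx := hM (x, t) ⟨hx, ht'⟩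
      have hMy := hM (y, t) ⟨hy, ht'⟩
      have hM0 : 0 ≤ M := (norm_nonneg _).trans hMx
      have hsin : ‖(x - y) * sin t‖ ≤ ‖y - x‖ := by
        rw [norm_mul, norm_sub_rev]
        exact mul_le_of_le_one_right (norm_nonneg _) (Real.abs_sin_le_one t)
      rw [smul_mul_assoc, norm_smul]
      refine mul_le_mul hsin ?_ (norm_nonneg _) (norm_nonneg _)
      calc _ ≤ ‖Ring.inverse (polDen (H + y • K) t)‖ * ‖K‖ *
              ‖Ring.inverse (polDen (H + x • K) t)‖ * ‖Ring.inverse (polDen (H + x • K) t)‖ :=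
            norm_mul_le_of_le (norm_mul₃_le ..) le_rfl
        _ ≤ M * ‖K‖ * M * M := by gcongr
        _ = _ := by ring
    rw [sub_zero, abs_of_pos Real.two_pi_pos] at hbound
    rw [hKK]
    refine (norm_mul_le _ _).trans ?_
    rw [norm_smul, norm_smul, Real.norm_of_nonneg (inv_nonneg.2 Real.two_pi_pos.le)]
    calc _ ≤ ‖y - x‖ * ‖K‖ * ((2 * pi)⁻¹ * (‖y - x‖ * (M * M * M * ‖K‖) * (2 * pi))) := by
          gcongr
      _ = _ := by ring
  have hderiv : ∀ x ∈ Set.Icc (0:ℝ) 1,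
      HasDerivWithinAt (fun r : ℝ => pol (H + r • K)) 0 (Set.Icc 0 1) x := by
    intro x hx
    rw [hasDerivWithinAt_iff_isLittleO]
    simp only [smul_zero, sub_zero]
    refine Asymptotics.IsBigO.trans_isLittleO (g := fun y => ‖y - x‖ ^ 2) ?_
      ((Asymptotics.isLittleO_pow_sub_sub x one_lt_two).mono nhdsWithin_le_nhds)
    refine Asymptotics.IsBigO.of_bound
      (‖K‖ * ((2 * pi)⁻¹ * (M * M * M * ‖K‖ * (2 * pi)))) ?_
    filter_upwards [self_mem_nhdsWithin] with y hy
    simpa using hdiff x hx y hy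
  have := constant_of_derivWithin_zero (fun x hx => (hderiv x hx).differentiableWithinAt)
    (fun x hx => (hderiv x (Set.Ico_subset_Icc_self hx)).derivWithin
      (uniqueDiffOn_Icc zero_lt_one x (Set.Ico_subset_Icc_self hx))) 1 (by simp)
  simpa using this

lemma pol_of_mul_self {Q : 𝔄} (hQ : Q * Q = -1) : pol Q = Q := by
  have h1 : ∀ t, polInt Q t = Q := by
    intro t
    rw [polInt, eq_comm, Ring.eq_mul_inverse_iff_mul_eq _ _ _ (isUnit_polDen_of_mul_self hQ t)]
    simp only [polDen, polNum, mul_add, mul_smul_comm, mul_one, hQ]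
    module
  rw [pol_eq]
  simp_rw [h1]
  rw [intervalIntegral.integral_const, sub_zero, smul_smul,
    inv_mul_cancel₀ Real.two_pi_pos.ne', one_smul]

lemma pol_eq_of_spectrum {H Q : 𝔄} (hQ : Q * Q = -1) (hHQ : Commute H Q)
    (hS : ∀ z : ℂ, z.re ≤ 0 → IsUnit (algebraMap ℂ 𝔄 z - H * -Q)) : pol H = Q := by
  have hseg := pol_add_eq_of_segment (H := Q) (K := H - Q) (hHQ.symm.sub_right (Commute.refl Q)) ?_
  · rwa [add_sub_cancel, pol_of_mul_self hQ] at hseg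
  intro r hr t
  have hcs := Real.sin_sq_add_cos_sq t
  have key : ∀ c s : ℝ, s ^ 2 + c ^ 2 = 1 → IsUnit ((c + Complex.I * s * (1 - r)) • (1 : 𝔄) +
      (Complex.I * s * r) • (H * -Q)) := by
    intro c s hcs
    refine isUnit_smul_one_add_smul_s11 hS (fun h0 h1 => ?_) (fun hb => ?_)
    · have h2 := congrArg Complex.re h1
      have h3 := congrArg Complex.im h1
      have h4 := congrArg Complex.im h0
      simp at h2 h3 h4
      simp only [h2] at hcs
      rcases h4 with h4 | h4
      · simp [h4] at hcs
      · simp only [h4, sub_zero, one_ne_zero, or_false] at h3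
        simp [h3] at hcs
    · have hs : (s : ℂ) ≠ 0 := fun h => hb (by simp [h])
      have hr0 : (r : ℂ) ≠ 0 := fun h => hb (by simp [h])
      have : -((c + Complex.I * s * (1 - r)) / (Complex.I * s * r)) =
          ((-((1 - r) / r) : ℝ) : ℂ) + ((c / (s * r) : ℝ) : ℂ) * Complex.I := by
        push_cast
        field_simp
        linear_combination -(c : ℂ) * Complex.I_sq
      rw [this]
      have h5 : 0 ≤ (1 - r) / r := div_nonneg (sub_nonneg.2 hr.2) hr.1
      rw [Complex.add_re, Complex.ofReal_re, Complex.re_ofReal_mul, Complex.I_re]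
      linarith
  have hprod : polDen (Q + r • (H - Q)) t * polDen (Q + r • (H - Q)) (-t) =
      ((cos t + Complex.I * sin t * (1 - r)) • (1 : 𝔄) +
        (Complex.I * sin t * r) • (H * -Q)) *
      ((cos t + Complex.I * (-sin t : ℝ) * (1 - r)) • (1 : 𝔄) +
        (Complex.I * (-sin t : ℝ) * r) • (H * -Q)) := by
    have h1 : H * (Q * (H * Q)) = - (H * H) := by
      rw [← mul_assoc Q, ← hHQ.eq, mul_assoc, hQ]; simp
    rw [polDen_neg, polDen]
    simp only [← Complex.coe_smul]
    simp only [mul_sub, mul_add, add_mul, sub_mul, smul_mul_assoc, mul_smul_comm, one_mul,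
      mul_one, hQ, mul_neg, neg_mul, ← hHQ.eq, smul_sub, smul_add, mul_assoc, h1]
    push_cast
    match_scalars <;> ring_nf <;> simp only [Complex.I_sq] <;> ring
  have hc : ∀ x : 𝔄, Commute (polDen x t) (polDen x (-t)) := fun x =>
    (((Commute.refl x).polDen_right t).symm).polDen_right (-t)
  exact ((hc _).isUnit_mul_iff.1 (hprod ▸ (key _ _ hcs).mul
    (key _ _ (by rwa [neg_sq])))).1

lemma integral_polInt_mul_polInt_add {H : 𝔄} (hu : ∀ t, IsUnit (polDen H t)) {v : ℝ}
    (hv : sin v ≠ 0) :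
    ∫ t in (0:ℝ)..(2 * pi), polInt H t * polInt H (t + v) = (-(2 * pi)) • (1 : 𝔄) := by
  have hc := continuous_polInt hu
  have hc' : Continuous fun t => polInt H (t + v) := by fun_prop
  have h1 : ∀ t, polInt H t * polInt H (t + v) =
      (cos v / sin v) • (polInt H t - polInt H (t + v)) - 1 := by
    intro t
    rw [div_eq_inv_mul, ← smul_smul, ← sin_smul_one_add_polInt_mul hu, smul_smul,
      inv_mul_cancel₀ hv, one_smul, add_sub_cancel_left]
  have h2 : ∫ t in (0:ℝ)..(2 * pi), polInt H (t + v) = ∫ t in (0:ℝ)..(2 * pi), polInt H t := by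
    simp_rw [add_comm _ v]
    exact integral_polInt_add v
  simp_rw [h1]
  rw [intervalIntegral.integral_sub
      (f := fun t => (cos v / sin v) • (polInt H t - polInt H (t + v)))
      (((hc.sub hc').const_smul _).intervalIntegrable _ _) (by simp),
    intervalIntegral.integral_smul, intervalIntegral.integral_sub (hc.intervalIntegrable _ _)
      (hc'.intervalIntegrable _ _), h2, sub_self, smul_zero, intervalIntegral.integral_const]
  simp

lemma pol_mul_pol {H : 𝔄} (hu : ∀ t, IsUnit (polDen H t)) : pol H * pol H = -1 := by
  have hc := continuous_polInt hu
  have h1 : (∫ t in (0:ℝ)..(2 * pi), polInt H t) * (∫ t in (0:ℝ)..(2 * pi), polInt H t) =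
      ∫ v in (0:ℝ)..(2 * pi), ∫ t in (0:ℝ)..(2 * pi), polInt H t * polInt H (t + v) := by
    rw [MeasureTheory.intervalIntegral_intervalIntegral_swap]
    · rw [← intervalIntegral_mul_right hc]
      refine intervalIntegral.integral_congr fun t _ => ?_
      rw [intervalIntegral_mul_left (f := fun v => polInt H (t + v)) (by fun_prop),
        integral_polInt_add]
    · refine IntegrableOn.mono_set (t := Set.uIcc 0 (2 * pi) ×ˢ Set.uIcc 0 (2 * pi)) ?_
        (Set.prod_mono Set.uIoc_subset_uIcc Set.uIoc_subset_uIcc)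
      refine ContinuousOn.integrableOn_compact (isCompact_uIcc.prod isCompact_uIcc)
        (Continuous.continuousOn ?_)
      unfold Function.uncurry
      fun_prop
  have h2 : ∫ v in (0:ℝ)..(2 * pi), ∫ t in (0:ℝ)..(2 * pi), polInt H t * polInt H (t + v) =
      ∫ v in (0:ℝ)..(2 * pi), (-(2 * pi)) • (1 : 𝔄) := by
    refine intervalIntegral.integral_congr_ae ?_
    have hfin : ({pi, 2 * pi} : Set ℝ).Finite := by simp
    filter_upwards [hfin.countable.ae_notMem volume] with v hv hv'
    refine integral_polInt_mul_polInt_add hu fun h0 => hv ?_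
    rw [Set.uIoc_of_le Real.two_pi_pos.le] at hv'
    obtain ⟨n, hn⟩ := Real.sin_eq_zero_iff.1 h0
    have h3 : (0 : ℝ) < n := by
      by_contra! h; nlinarith [hv'.1, Real.pi_pos]
    have h4 : (n : ℝ) ≤ 2 := by
      by_contra! h; nlinarith [hv'.2, Real.pi_pos]
    have h5 : 0 < n := by exact_mod_cast h3
    have h6 : n ≤ 2 := by exact_mod_cast h4
    obtain rfl | rfl : n = 1 ∨ n = 2 := by lia
    · left; rw [← hn]; simp
    · right; rw [← hn]; simp
  rw [pol_eq, smul_mul_assoc, mul_smul_comm, h1, h2, intervalIntegral.integral_const, sub_zero,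
    smul_smul, smul_smul, smul_smul]
  have h3 := Real.pi_pos.ne'
  rw [← neg_one_smul ℝ (1 : 𝔄)]
  congr 1
  field_simp

lemma pol_algebraMap {z e : ℂ} (he : e * e = -1) (hz : 0 < (-(z * e)).re) :
    pol (algebraMap ℂ 𝔄 z) = algebraMap ℂ 𝔄 e := by
  refine pol_eq_of_spectrum (by rw [← map_mul, he, map_neg, map_one])
    (Algebra.commutes _ _) fun w hw => ?_
  rw [← map_neg, ← map_mul, ← map_sub]
  refine (IsUnit.mk0 _ fun h => ?_).map _
  have := congrArg Complex.re h
  rw [mul_neg, Complex.sub_re, Complex.zero_re] at this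
  linarith

lemma exists_sub_algebraMap_mul_eq {H : 𝔄} (hspec : ∀ z ∈ spectrum ℂ H, z.im ≠ 0) {z e : ℂ}
    (he : e * e = -1) (hz : 0 ≤ (-(z * e)).re) :
    ∃ X, Commute X H ∧ (H - algebraMap ℂ 𝔄 z) * X = pol H - algebraMap ℂ 𝔄 e := by
  have hu := isUnit_polDen hspec
  have hzH : Commute H (algebraMap ℂ 𝔄 z) := (Algebra.commutes z H).symm
  have hPH : Commute H (pol H) := (Commute.refl H).pol_right hu
  have him : z.im = 0 ∨ 0 < (-(z * e)).re := by
    rcases hz.eq_or_lt with h | h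
    · left
      rcases eq_I_or_eq_neg_I he with rfl | rfl <;> simpa [eq_comm] using h
    · exact Or.inr h
  rcases him with h0 | hpos
  · have hunit : IsUnit (H - algebraMap ℂ 𝔄 z) := by
      rw [← neg_sub]
      exact (spectrum.notMem_iff.1 fun h => hspec z h h0).neg
    refine ⟨Ring.inverse (H - algebraMap ℂ 𝔄 z) * (pol H - algebraMap ℂ 𝔄 e), ?_, ?_⟩
    · exact ((((Commute.refl H).sub_right hzH).ringInverse_of_commute).mul_right
        (hPH.sub_right (Algebra.commutes e H).symm)).symm
    · rw [← mul_assoc, Ring.mul_inverse_cancel _ hunit, one_mul]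
  · have hz0 : z.im ≠ 0 := by
      intro h
      rcases eq_I_or_eq_neg_I he with rfl | rfl <;> simp [h] at hpos
    have hu' : ∀ t, IsUnit (polDen (algebraMap ℂ 𝔄 z) t) := isUnit_polDen_algebraMap hz0
    have hc := (continuous_inverse_of_isUnit (continuous_polDen H) hu).mul
      (continuous_inverse_of_isUnit (continuous_polDen (algebraMap ℂ 𝔄 z)) hu')
    refine ⟨_, ?_, by rw [← pol_algebraMap he hpos, pol_sub_pol hu hu' hzH]⟩
    exact (Commute.smul_right (Commute.intervalIntegral_right hc (fun t =>
      ((Commute.refl H).inverse_polDen_right t).mul_right (hzH.inverse_polDen_right t)) _ _) _).symm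

lemma exists_mul_neg_pol_sub_mul_eq {H : 𝔄} (hspec : ∀ z ∈ spectrum ℂ H, z.im ≠ 0) {z e : ℂ}
    (he : e * e = -1) (hz : z.re ≤ 0) :
    ∃ T, Commute T (H * -pol H - algebraMap ℂ 𝔄 z) ∧
      (H * -pol H - algebraMap ℂ 𝔄 z) * T = (2 : ℂ) • (pol H - algebraMap ℂ 𝔄 e) := by
  have hu := isUnit_polDen hspec
  have hP := pol_mul_pol hu
  have hPH : Commute H (pol H) := (Commute.refl H).pol_right hu
  have hz' : -(-(e * z) * e) = -z := by linear_combination z * he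
  obtain ⟨X, hXH, hX⟩ := exists_sub_algebraMap_mul_eq hspec (z := -(e * z)) he
    (by rw [hz', Complex.neg_re]; linarith)
  have hXP : Commute X (pol H) := hXH.pol_right hu
  have hXe : Commute X (pol H - algebraMap ℂ 𝔄 e) := hXP.sub_right (Algebra.commutes e X).symm
  have h1 : (H * -pol H - algebraMap ℂ 𝔄 z) * (pol H - algebraMap ℂ 𝔄 e) =
      e • ((H - algebraMap ℂ 𝔄 (-(e * z))) * (pol H - algebraMap ℂ 𝔄 e)) := by
    simp only [Algebra.algebraMap_eq_smul_one, mul_sub, sub_mul, mul_neg, neg_mul, mul_assoc, hP,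
      smul_mul_assoc, mul_smul_comm, mul_one, one_mul]
    match_scalars <;> grind
  refine ⟨(pol H - algebraMap ℂ 𝔄 e) * X, ?_, ?_⟩
  · refine Commute.sub_right (Commute.mul_right ?_ (Commute.neg_right ?_))
      (Algebra.commutes z _).symm
    · exact (hPH.sub_right (Algebra.commutes e H).symm).symm.mul_left hXH
    · exact (((Commute.refl (pol H)).sub_right (Algebra.commutes e _).symm).symm).mul_left hXP
  · rw [← mul_assoc, h1, smul_mul_assoc, mul_assoc, ← hXe.eq, ← mul_assoc, hX]
    simp only [Algebra.algebraMap_eq_smul_one, mul_sub, sub_mul, hP, smul_mul_assoc, mul_smul_comm,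
      mul_one, one_mul]
    match_scalars <;> grind

lemma isUnit_algebraMap_sub_mul_neg_pol {H : 𝔄} (hspec : ∀ z ∈ spectrum ℂ H, z.im ≠ 0) {z : ℂ}
    (hz : z.re ≤ 0) : IsUnit (algebraMap ℂ 𝔄 z - H * -pol H) := by
  obtain ⟨T, hTc, hT⟩ := exists_mul_neg_pol_sub_mul_eq hspec Complex.I_mul_I hz
  obtain ⟨U, hUc, hU⟩ := exists_mul_neg_pol_sub_mul_eq hspec (e := -Complex.I) (by simp) hz
  have h : (H * -pol H - algebraMap ℂ 𝔄 z) * (U - T) = algebraMap ℂ 𝔄 (4 * Complex.I) := by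
    rw [mul_sub, hT, hU]
    simp only [Algebra.algebraMap_eq_smul_one]
    module
  rw [← neg_sub]
  exact ((hUc.sub_left hTc).symm.isUnit_mul_iff.1
    (h ▸ (IsUnit.mk0 _ (by simp)).map _)).1.neg

end Polarization

section Antisymmetrization

variable {𝔄 : Type*} [Ring 𝔄]

lemma ringInverse_eq_neg_of_mul_self {q : 𝔄} (hq : q * q = -1) : Ring.inverse q = -q :=
  Ring.inverse_unit (⟨q, -q, by simp [hq], by simp [hq]⟩ : 𝔄ˣ)

lemma gsAntisym_congr [Module ℝ 𝔄] {n : ℕ} {P Q : Fin n → 𝔄} {k : Fin n}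
    (h : ∀ i < k, P i = Q i) (R : 𝔄) : gsAntisym P k R = gsAntisym Q k R := by
  unfold gsAntisym
  congr 2
  funext i
  exact h _ (Fin.lt_def.2 i.isLt)

variable [Algebra ℝ 𝔄]

lemma mul_antisym_self {q : 𝔄} (hq : q * q = -1) (R : 𝔄) :
    q * antisym q R = -(antisym q R * q) := by
  have h1 : q * (q * (R * q)) = -(R * q) := by rw [← mul_assoc, hq, neg_one_mul]
  rw [antisym, ringInverse_eq_neg_of_mul_self hq]
  simp only [mul_smul_comm, smul_mul_assoc, mul_sub, sub_mul, neg_mul, mul_neg, mul_assoc, hq, h1,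
    mul_one]
  module

lemma mul_antisym_of_anticommute {p q R : 𝔄} (hq : q * q = -1) (hpq : p * q = -(q * p))
    (hR : p * R = -(R * p)) : p * antisym q R = -(antisym q R * p) := by
  have h1 : p * (q * (R * q)) = -(q * (R * (q * p))) := by
    rw [← mul_assoc, hpq, neg_mul, mul_assoc, ← mul_assoc p, hR, neg_mul, mul_assoc, hpq]
    simp
  rw [antisym, ringInverse_eq_neg_of_mul_self hq]
  simp only [mul_smul_comm, smul_mul_assoc, mul_sub, sub_mul, neg_mul, mul_neg, mul_assoc, hR, h1]
  module

lemma mul_foldl_antisym_of_anticommute {p : 𝔄} (l : List 𝔄) (hl : ∀ q ∈ l, q * q = -1)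
    (hpl : ∀ q ∈ l, p * q = -(q * p)) {R : 𝔄} (hR : p * R = -(R * p)) :
    p * l.foldl (fun R q => antisym q R) R = -(l.foldl (fun R q => antisym q R) R * p) := by
  induction l generalizing R with
  | nil => exact hR
  | cons q l ih =>
    rw [List.forall_mem_cons] at hl hpl
    exact ih hl.2 hpl.2 (mul_antisym_of_anticommute hl.1 hpl.1 hR)

lemma mul_foldl_antisym_of_mem (l : List 𝔄) (hl : ∀ q ∈ l, q * q = -1)
    (hpl : l.Pairwise fun p q => p * q = -(q * p)) (R : 𝔄) {p : 𝔄} (hp : p ∈ l) :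
    p * l.foldl (fun R q => antisym q R) R = -(l.foldl (fun R q => antisym q R) R * p) := by
  induction l generalizing R with
  | nil => simp at hp
  | cons q l ih =>
    rw [List.forall_mem_cons] at hl
    rw [List.pairwise_cons] at hpl
    rcases List.mem_cons.1 hp with rfl | hp
    · exact mul_foldl_antisym_of_anticommute l hl.2 hpl.1 (mul_antisym_self hl.1 R)
    · exact ih hl.2 hpl.2 _ hp

lemma mul_gsAntisym {n : ℕ} {Q : Fin n → 𝔄} {k : Fin n} (hsq : ∀ i < k, Q i * Q i = -1)
    (hanti : ∀ j < k, ∀ i < j, Q i * Q j = -(Q j * Q i)) {i : Fin n} (hi : i < k) (R : 𝔄) :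
    Q i * gsAntisym Q k R = -(gsAntisym Q k R * Q i) := by
  refine mul_foldl_antisym_of_mem _ ?_ ?_ R ?_
  · rw [List.forall_mem_ofFn_iff]
    exact fun j => hsq _ (Fin.lt_def.2 j.isLt)
  · rw [List.pairwise_ofFn]
    exact fun a b hab => hanti _ (Fin.lt_def.2 b.isLt) _ (Fin.lt_def.2 hab)
  · rw [List.mem_ofFn]
    exact ⟨⟨i, hi⟩, rfl⟩

end Antisymmetrization

theorem stmt11 {𝔄 : Type*} [NormedRing 𝔄] [NormedAlgebra ℂ 𝔄] [CompleteSpace 𝔄]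
    {n : ℕ} (A Qgs Hgs : Fin n → 𝔄)
    -- `(Qgs, Hgs)` is the Gram–Schmidt recursion data for `A`, and `A` lies in the
    -- domain of `𝒪^GS` (all relevant spectra are disjoint from `ℝ`):
    (hH : ∀ k : Fin n, Hgs k = gsAntisym Qgs k (A k))
    (hspec : ∀ k : Fin n, ∀ z ∈ spectrum ℂ (Hgs k), z.im ≠ 0)
    (hQ : ∀ k : Fin n, Qgs k = pol (Hgs k))
    (Q : Fin n → 𝔄) :
    Qgs = Q ↔
      (IsCliffordSystem Q ∧
        (∀ k : Fin n, gsAntisym Q k (A k) * Q k = Q k * gsAntisym Q k (A k)) ∧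
        (∀ k : Fin n, ∀ z ∈ spectrum ℂ (gsAntisym Q k (A k) * (-(Q k))), 0 < z.re)) := by
  constructor
  · rintro rfl
    have hu := fun k => isUnit_polDen (hspec k)
    have hsq : ∀ k, Qgs k * Qgs k = -1 := fun k => by rw [hQ k, pol_mul_pol (hu k)]
    have hanti : ∀ k, ∀ i < k, Qgs i * Qgs k = -(Qgs k * Qgs i) := by
      intro k
      induction k using WellFoundedLT.induction with
      | ind k ih =>
        intro i hi
        have h1 := mul_gsAntisym (fun i _ => hsq i) ih hi (A k)
        rw [← hH] at h1
        rw [hQ k]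
        exact mul_pol_of_anticommute (hu k) h1
    refine ⟨fun i j => ?_, fun k => ?_, fun k z hz => ?_⟩
    · rcases lt_trichotomy i j with h | rfl | h
      · rw [if_neg h.ne, hanti j i h, neg_add_cancel]
      · rw [if_pos rfl, hsq]
        norm_num
      · rw [if_neg h.ne', hanti i j h, add_neg_cancel]
    · rw [← hH, hQ k]
      exact (Commute.refl _).pol_right (hu k)
    · by_contra! hre
      rw [← hH, hQ k] at hz
      exact hz (isUnit_algebraMap_sub_mul_neg_pol (hspec k) hre)
  · rintro ⟨hcl, hcomm, hpos⟩
    funext k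
    induction k using WellFoundedLT.induction with
    | ind k ih =>
      have hsq : Q k * Q k = -1 := by
        have h := hcl k k
        rw [if_pos rfl, ← two_smul ℂ] at h
        have h2 : (2 : ℂ) • (Q k * Q k) = (2 : ℂ) • (-1 : 𝔄) := by
          rw [h, two_smul]
          norm_num
        exact smul_right_injective 𝔄 (two_ne_zero (α := ℂ)) h2
      rw [hQ k, hH k, gsAntisym_congr ih]
      exact pol_eq_of_spectrum hsq (hcomm k) fun z hz =>
        spectrum.notMem_iff.1 fun h => (hpos k z h).not_ge hz
end
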